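/- Let λ > 0, 0 < δ < 1/2, m > 0 and let Ω ⊂ ℝ² be a set of finite perimeter with |Ω| = m. Define E_{λ,δ}(Ω) = P(Ω) - (λ/(4|log δ|)) ∫∫ |χ_Ω(x+z) - χ_Ω(x)|² g_δ(|z|)/|z|³ dz dx. If P(Ω) ≤ πm/δ, then E_{λ,δ}(Ω) ≥ (1 - λ + (λ/|log δ|) · log(P(Ω)/(eπm))) · P(Ω). If instead P(Ω) > πm/δ, then E_{λ,δ}(Ω) ≥ (1 - λ/|log δ|) · P(Ω). -/

import Mathlib

open MeasureTheory Real Filter Set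

noncomputable section

/-- The plane `ℝ²`. -/
abbrev Plane := EuclideanSpace ℝ (Fin 2)

/-- Divergence of a vector field on the plane. -/
def divg (φ : Plane → Plane) (x : Plane) : ℝ :=
  ∑ i : Fin 2, fderiv ℝ φ x (EuclideanSpace.single i 1) i

/-- The set of values `∫_Ω div φ` over admissible test vector fields. -/
def perimVals (Ω : Set Plane) : Set ℝ :=
  {s | ∃ φ : Plane → Plane, ContDiff ℝ 1 φ ∧ HasCompactSupport φ ∧
        (∀ x, ‖φ x‖ ≤ 1) ∧ s = ∫ x in Ω, divg φ x}

/-- The De Giorgi perimeter of a set in the plane. -/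
def perim (Ω : Set Plane) : ℝ := sSup (perimVals Ω)

/-- A set has finite perimeter if the defining supremum is finite. -/
def HasFinPer (Ω : Set Plane) : Prop := BddAbove (perimVals Ω)

/-- The cutoff function `g_δ(r) = χ_{(δ,∞)}(r)`. -/
def gdel (δ r : ℝ) : ℝ := if δ < r then 1 else 0

/-- Characteristic function of a set. -/
def ind (Ω : Set Plane) : Plane → ℝ := Set.indicator Ω 1

/-- The (rescaled) nonlocal dipolar term. -/
def nlE (δ : ℝ) (Ω : Set Plane) : ℝ :=
  ∫ x : Plane, ∫ z : Plane, |ind Ω (x + z) - ind Ω x| ^ 2 * (gdel δ ‖z‖ / ‖z‖ ^ 3)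

/-- The energy `E_{λ,δ}`. -/
def Eenergy (lam δ : ℝ) (Ω : Set Plane) : ℝ :=
  perim Ω - lam / (4 * |Real.log δ|) * nlE δ Ω

end

open scoped ENNReal Topology

/-- Integration over the plane in polar coordinates. -/
lemma lintegral_plane_polar {F : Plane → ℝ≥0∞} (hF : Measurable F) :
    ∫⁻ z, F z = ∫⁻ r in Ioi (0 : ℝ), ∫⁻ θ in Ioo (-π) π,
      ENNReal.ofReal r * F !₂[r * cos θ, r * sin θ] := by
  have h1 : MeasurePreserving (fun p : ℝ × ℝ => (!₂[p.1, p.2] : Plane)) :=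
    (PiLp.volume_preserving_toLp (Fin 2)).comp (volume_preserving_finTwoArrow ℝ).symm
  have hm : Measurable (fun p : ℝ × ℝ =>
      ENNReal.ofReal p.1 * F !₂[p.1 * cos p.2, p.1 * sin p.2]) := by
    have hp : Measurable fun p : ℝ × ℝ => (p.1 * cos p.2, p.1 * sin p.2) := by fun_prop
    exact Measurable.mul (by fun_prop) (hF.comp (h1.measurable.comp hp))
  rw [← h1.lintegral_comp hF, ← lintegral_comp_polarCoord_symm, polarCoord_target,
    Measure.volume_eq_prod, ← Measure.prod_restrict]
  simp only [polarCoord_symm_apply, smul_eq_mul]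
  rw [lintegral_prod _ hm.aemeasurable]

lemma integral_abs_cos : ∫ θ in (-π)..π, |cos θ| = 4 := by
  have hper : Function.Periodic (fun θ => |cos θ|) (2 * π) := fun θ => by simp
  have h := hper.intervalIntegral_add_eq (-π) (-(π / 2))
  have e1 : -π + 2 * π = π := by ring
  have e2 : -(π / 2) + 2 * π = π / 2 + π := by ring
  rw [e1, e2] at h
  have hc : Continuous fun θ : ℝ => |cos θ| := by fun_prop
  rw [h, ← intervalIntegral.integral_add_adjacent_intervals (b := π / 2)
    (hc.intervalIntegrable _ _) (hc.intervalIntegrable _ _)]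
  have i1 : ∫ θ in (-(π / 2))..(π / 2), |cos θ| = 2 := by
    rw [intervalIntegral.integral_congr (g := cos)]
    · simp; norm_num
    · intro θ hθ
      rw [uIcc_of_le (by linarith [pi_pos])] at hθ
      exact abs_of_nonneg (cos_nonneg_of_mem_Icc hθ)
  have i2 : ∫ θ in (π / 2)..(π / 2 + π), |cos θ| = 2 := by
    rw [intervalIntegral.integral_congr (g := fun θ => -cos θ)]
    · simp [sin_add]; norm_num
    · intro θ hθ
      rw [uIcc_of_le (by linarith [pi_pos])] at hθ
      exact abs_of_nonpos (cos_nonpos_of_pi_div_two_le_of_le hθ.1 (by linarith [hθ.2]))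
  rw [i1, i2]; norm_num

lemma lintegral_abs_inner_circle (v : Plane) :
    ∫⁻ θ in Ioo (-π) π, ENNReal.ofReal |v 0 * cos θ + v 1 * sin θ| = ENNReal.ofReal (4 * ‖v‖) := by
  obtain ⟨α, h0, h1⟩ : ∃ α, v 0 = ‖v‖ * cos α ∧ v 1 = ‖v‖ * sin α := by
    have hn : ‖(⟨v 0, v 1⟩ : ℂ)‖ = ‖v‖ := by
      rw [EuclideanSpace.norm_eq, Complex.norm_eq_sqrt_sq_add_sq]; simp
    refine ⟨Complex.arg ⟨v 0, v 1⟩, ?_, ?_⟩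
    · rw [← hn, Complex.norm_mul_cos_arg]
    · rw [← hn, Complex.norm_mul_sin_arg]
  have hpi := pi_pos
  have hfun : ∀ θ, |v 0 * cos θ + v 1 * sin θ| = ‖v‖ * |cos (θ - α)| := fun θ => by
    rw [h0, h1, cos_sub, ← abs_of_nonneg (norm_nonneg v), ← abs_mul, abs_of_nonneg (norm_nonneg v)]
    ring_nf
  have hper : Function.Periodic (fun θ => |cos θ|) (2 * π) := fun θ => by simp
  simp only [hfun]
  have hc : Continuous fun θ : ℝ => ‖v‖ * |cos (θ - α)| := by fun_prop
  rw [← ofReal_integral_eq_lintegral_ofReal, ← integral_Ioc_eq_integral_Ioo,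
    ← intervalIntegral.integral_of_le (by linarith), intervalIntegral.integral_const_mul,
    intervalIntegral.integral_comp_sub_right (fun θ => |cos θ|)]
  · have h := hper.intervalIntegral_add_eq (-π - α) (-π)
    have e1 : -π - α + 2 * π = π - α := by ring
    have e2 : -π + 2 * π = π := by ring
    rw [e1, e2] at h
    rw [h, integral_abs_cos, mul_comm]
  · exact (hc.integrableOn_Icc (a := -π) (b := π)).mono_set Ioo_subset_Icc_self
  · exact ae_of_all _ fun θ => by positivity

lemma norm_polar {r : ℝ} (hr : 0 < r) (θ : ℝ) : ‖(!₂[r * cos θ, r * sin θ] : Plane)‖ = r := by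
  rw [EuclideanSpace.norm_eq]
  simp only [norm_eq_abs, sq_abs, Fin.sum_univ_two, Matrix.cons_val_zero,
    Matrix.cons_val_one]
  rw [show (r * cos θ) ^ 2 + (r * sin θ) ^ 2 = r ^ 2 by
    linear_combination r ^ 2 * sin_sq_add_cos_sq θ, sqrt_sq hr.le]

/-- The exact small-scale integral against a linear functional. -/
lemma lintegral_annulus_abs_inner {δ R : ℝ} (hδ : 0 < δ) (hR : δ ≤ R) (v : Plane) :
    ∫⁻ z : Plane, (if δ < ‖z‖ ∧ ‖z‖ ≤ R then ENNReal.ofReal (1 / ‖z‖ ^ 3) else 0) *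
      ENNReal.ofReal |inner ℝ v z| = ENNReal.ofReal (4 * log (R / δ)) * ENNReal.ofReal ‖v‖ := by
  have hmeas : Measurable fun z : Plane =>
      (if δ < ‖z‖ ∧ ‖z‖ ≤ R then ENNReal.ofReal (1 / ‖z‖ ^ 3) else 0) *
        ENNReal.ofReal |inner ℝ v z| := by
    refine Measurable.mul (Measurable.ite ?_ (by fun_prop) (by fun_prop)) (by fun_prop)
    exact (measurableSet_lt measurable_const measurable_norm).inter
      (measurableSet_le measurable_norm measurable_const)
  rw [lintegral_plane_polar hmeas]
  have key : ∀ r ∈ Ioi (0 : ℝ), (∫⁻ θ in Ioo (-π) π, ENNReal.ofReal r *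
      ((if δ < ‖(!₂[r * cos θ, r * sin θ] : Plane)‖ ∧ ‖(!₂[r * cos θ, r * sin θ] : Plane)‖ ≤ R
        then ENNReal.ofReal (1 / ‖(!₂[r * cos θ, r * sin θ] : Plane)‖ ^ 3) else 0) *
        ENNReal.ofReal |inner ℝ v (!₂[r * cos θ, r * sin θ] : Plane)|)) =
      (Ioc δ R).indicator (fun r => ENNReal.ofReal (1 / r)) r * ENNReal.ofReal (4 * ‖v‖) := by
    intro r hr
    have hr' : 0 < r := hr
    simp only [norm_polar hr']
    by_cases h : δ < r ∧ r ≤ R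
    · rw [indicator_of_mem (show r ∈ Ioc δ R from h), ← lintegral_abs_inner_circle v,
        ← lintegral_const_mul _ (by fun_prop)]
      refine lintegral_congr fun θ => ?_
      have : inner ℝ v (!₂[r * cos θ, r * sin θ] : Plane) = r * (v 0 * cos θ + v 1 * sin θ) := by
        simp [PiLp.inner_apply, Fin.sum_univ_two]; ring
      rw [if_pos h, this, abs_mul, abs_of_pos hr', ← ENNReal.ofReal_mul (by positivity),
        ← ENNReal.ofReal_mul (by positivity), ← ENNReal.ofReal_mul (by positivity)]
      congr 1
      field_simp
    · rw [indicator_of_notMem (show r ∉ Ioc δ R from h)]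
      simp [h]
  rw [setLIntegral_congr_fun measurableSet_Ioi key,
    lintegral_mul_const _ (Measurable.indicator (by fun_prop) measurableSet_Ioc),
    lintegral_indicator measurableSet_Ioc, Measure.restrict_restrict measurableSet_Ioc,
    inter_eq_left.2 (show Ioc δ R ⊆ Ioi 0 from fun r hr => lt_trans hδ hr.1)]
  have hlog : ∫⁻ r in Ioc δ R, ENNReal.ofReal (1 / r) = ENNReal.ofReal (log (R / δ)) := by
    rw [← ofReal_integral_eq_lintegral_ofReal, ← intervalIntegral.integral_of_le hR,
      integral_one_div_of_pos hδ (hδ.trans_le hR)]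
    · refine IntegrableOn.mono_set (t := Icc δ R) ?_ Ioc_subset_Icc_self
      exact ContinuousOn.integrableOn_Icc (continuousOn_const.div continuousOn_id
        fun r hr => (hδ.trans_le hr.1).ne')
    · filter_upwards [ae_restrict_mem measurableSet_Ioc] with r hr
      have := hδ.trans hr.1
      positivity
  have hl0 : 0 ≤ log (R / δ) := log_nonneg ((one_le_div hδ).2 hR)
  rw [hlog, ← ENNReal.ofReal_mul hl0, ← ENNReal.ofReal_mul (by positivity)]
  congr 1; ring

/-- The exact large-scale integral of the kernel. -/
lemma lintegral_tail {R : ℝ} (hR : 0 < R) :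
    ∫⁻ z : Plane, (if R < ‖z‖ then ENNReal.ofReal (1 / ‖z‖ ^ 3) else 0) =
      ENNReal.ofReal (2 * π / R) := by
  have hmeas : Measurable fun z : Plane =>
      (if R < ‖z‖ then ENNReal.ofReal (1 / ‖z‖ ^ 3) else 0) :=
    Measurable.ite (measurableSet_lt measurable_const measurable_norm) (by fun_prop) (by fun_prop)
  rw [lintegral_plane_polar hmeas]
  have key : ∀ r ∈ Ioi (0 : ℝ), (∫⁻ θ in Ioo (-π) π, ENNReal.ofReal r *
      (if R < ‖(!₂[r * cos θ, r * sin θ] : Plane)‖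
        then ENNReal.ofReal (1 / ‖(!₂[r * cos θ, r * sin θ] : Plane)‖ ^ 3) else 0)) =
      (Ioi R).indicator (fun r => ENNReal.ofReal (r ^ (-2 : ℝ))) r * ENNReal.ofReal (2 * π) := by
    intro r hr
    have hr' : 0 < r := hr
    simp only [norm_polar hr']
    by_cases h : R < r
    · rw [indicator_of_mem (show r ∈ Ioi R from h), if_pos h, setLIntegral_const, volume_Ioo,
        ← ENNReal.ofReal_mul hr'.le, rpow_neg hr'.le]
      norm_cast
      congr 2
      · field_simp
      · ring
    · rw [indicator_of_notMem (show r ∉ Ioi R from h)]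
      simp [h]
  rw [setLIntegral_congr_fun measurableSet_Ioi key,
    lintegral_mul_const _ (Measurable.indicator (by fun_prop) measurableSet_Ioi),
    lintegral_indicator measurableSet_Ioi, Measure.restrict_restrict measurableSet_Ioi,
    inter_eq_left.2 (Ioi_subset_Ioi hR.le),
    ← ofReal_integral_eq_lintegral_ofReal (integrableOn_Ioi_rpow_of_lt (by norm_num) hR)
      (by filter_upwards [ae_restrict_mem measurableSet_Ioi] with r hr
          exact rpow_nonneg (hR.trans hr).le _),
    integral_Ioi_rpow_of_lt (by norm_num) hR, ← ENNReal.ofReal_mul (by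
      norm_num; exact rpow_nonneg hR.le _)]
  congr 1
  norm_num
  rw [rpow_neg_one]
  field_simp

lemma integral_mul_divg {f : Plane → ℝ} {φ : Plane → Plane} (hf : ContDiff ℝ 1 f)
    (hφ : ContDiff ℝ 1 φ) (hc : HasCompactSupport φ) :
    ∫ x, f x * divg φ x = -∫ x, inner ℝ (gradient f x) (φ x) := by
  have hcomp : ∀ i, ContDiff ℝ 1 fun x => φ x i := fun i => by fun_prop
  have hci : ∀ i, HasCompactSupport fun x => φ x i := fun i =>
    hc.comp_left (g := fun y : Plane => y i) rfl
  have hder : ∀ i x, fderiv ℝ φ x (EuclideanSpace.single i 1) i =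
      fderiv ℝ (fun x => φ x i) x (EuclideanSpace.single i 1) := fun i x => by
    have h := (hφ.differentiable one_ne_zero x).hasFDerivAt
    have h2 := ((EuclideanSpace.proj i : Plane →L[ℝ] ℝ).hasFDerivAt.comp x h).fderiv
    have h3 : fderiv ℝ (fun x => φ x i) x =
      (EuclideanSpace.proj i : Plane →L[ℝ] ℝ).comp (fderiv ℝ φ x) := h2
    rw [h3]; rfl
  have hfd : ∀ i : Fin 2, Continuous fun x => fderiv ℝ f x (EuclideanSpace.single i 1) := fun i =>
    (hf.continuous_fderiv one_ne_zero).clm_apply continuous_const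
  have hφd : ∀ i : Fin 2, Continuous fun x =>
      fderiv ℝ (fun x => φ x i) x (EuclideanSpace.single i 1) := fun i =>
    ((hcomp i).continuous_fderiv one_ne_zero).clm_apply continuous_const
  have hφdc : ∀ i : Fin 2, HasCompactSupport fun x =>
      fderiv ℝ (fun x => φ x i) x (EuclideanSpace.single i 1) := fun i =>
    (hci i).fderiv_apply ℝ _
  have i1 : ∀ i : Fin 2, Integrable fun x =>
      f x * fderiv ℝ (fun x => φ x i) x (EuclideanSpace.single i 1) := fun i =>
    (hf.continuous.mul (hφd i)).integrable_of_hasCompactSupport (hφdc i).mul_left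
  have i2 : ∀ i : Fin 2, Integrable fun x =>
      fderiv ℝ f x (EuclideanSpace.single i 1) * φ x i := fun i =>
    ((hfd i).mul (hcomp i).continuous).integrable_of_hasCompactSupport (hci i).mul_left
  have i3 : ∀ i : Fin 2, Integrable fun x => f x * φ x i := fun i =>
    (hf.continuous.mul (hcomp i).continuous).integrable_of_hasCompactSupport (hci i).mul_left
  have ibp : ∀ i : Fin 2, ∫ x, f x * fderiv ℝ (fun x => φ x i) x (EuclideanSpace.single i 1) =
      -∫ x, fderiv ℝ f x (EuclideanSpace.single i 1) * φ x i := fun i =>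
    integral_mul_fderiv_eq_neg_fderiv_mul_of_integrable (i2 i) (i1 i) (i3 i)
      (fun x _ => hf.differentiable one_ne_zero x)
      (fun x _ => (hcomp i).differentiable one_ne_zero x)
  have hinner : ∀ x, inner ℝ (gradient f x) (φ x) =
      ∑ i, fderiv ℝ f x (EuclideanSpace.single i 1) * φ x i := fun x => by
    rw [gradient, InnerProductSpace.toDual_symm_apply]
    conv_lhs => rw [← (EuclideanSpace.basisFun (Fin 2) ℝ).sum_repr (φ x), map_sum]
    simp [mul_comm]
  simp only [divg, hder, hinner, Finset.mul_sum]
  rw [integral_finsetSum _ fun i _ => i1 i, integral_finsetSum _ fun i _ => i2 i,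
    ← Finset.sum_neg_distrib]
  exact Finset.sum_congr rfl fun i _ => ibp i

/-- Duality: the `L¹` norm of a gradient is controlled by pairings with divergences. -/
lemma lintegral_norm_gradient_le {f : Plane → ℝ} (hf : ContDiff ℝ 2 f) {P : ℝ}
    (h : ∀ φ : Plane → Plane, ContDiff ℝ 1 φ → HasCompactSupport φ → (∀ x, ‖φ x‖ ≤ 1) →
      ∫ x, f x * divg φ x ≤ P) :
    ∫⁻ x, ENNReal.ofReal ‖gradient f x‖ ≤ ENNReal.ofReal P := by
  have hG : ContDiff ℝ 1 (gradient f) :=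
    (InnerProductSpace.toDual ℝ Plane).symm.contDiff.comp (hf.fderiv_right (m := 1) le_rfl)
  let η : ℕ → ContDiffBump (0 : Plane) := fun k => ⟨k + 1, k + 2, by positivity, by linarith⟩
  let ε : ℕ → ℝ := fun k => 1 / ((k : ℝ) + 1)
  have hε : ∀ k, 0 < ε k := fun k => Nat.one_div_pos_of_nat
  have hden : ∀ k x, 0 < √(ε k ^ 2 + ‖gradient f x‖ ^ 2) := fun k x => by
    have := hε k
    positivity
  let w : ℕ → Plane → ℝ := fun k x => η k x / √(ε k ^ 2 + ‖gradient f x‖ ^ 2)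
  have hw : ∀ k, ContDiff ℝ 1 (w k) := fun k => by
    refine (η k).contDiff.div (ContDiff.sqrt (contDiff_const.add (hG.norm_sq ℝ)) fun x => ?_)
      fun x => (hden k x).ne'
    have := hε k
    positivity
  have hwc : ∀ k, HasCompactSupport (w k) := fun k => (η k).hasCompactSupport.mul_right
  have hw0 : ∀ k x, 0 ≤ w k x := fun k x => div_nonneg (η k).nonneg (hden k x).le
  have hw1 : ∀ k x, w k x * ‖gradient f x‖ ≤ 1 := fun k x => by
    have h1 : ‖gradient f x‖ ≤ √(ε k ^ 2 + ‖gradient f x‖ ^ 2) :=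
      le_sqrt_of_sq_le (by linarith [sq_nonneg (ε k)])
    rw [div_mul_eq_mul_div, div_le_one (hden k x)]
    exact (mul_le_of_le_one_left (norm_nonneg _) (η k).le_one).trans h1
  have hbound : ∀ k, ∫⁻ x, ENNReal.ofReal (w k x * ‖gradient f x‖ ^ 2) ≤ ENNReal.ofReal P := by
    intro k
    have hφ : ContDiff ℝ 1 fun x => -(w k x • gradient f x) := ((hw k).smul hG).neg
    have hφc : HasCompactSupport fun x => -(w k x • gradient f x) := by
      refine (hwc k).mono fun x hx => ?_
      contrapose! hx
      simp at hx
      simp [hx]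
    have h1 := h _ hφ hφc fun x => by
      rw [norm_neg, norm_smul, norm_of_nonneg (hw0 k x)]
      exact hw1 k x
    rw [integral_mul_divg (hf.of_le one_le_two) hφ hφc, ← integral_neg] at h1
    simp only [inner_neg_right, neg_neg, inner_smul_right, real_inner_self_eq_norm_sq] at h1
    rw [← ofReal_integral_eq_lintegral_ofReal]
    · exact ENNReal.ofReal_le_ofReal h1
    · exact ((hw k).continuous.mul (hG.continuous.norm.pow 2)).integrable_of_hasCompactSupport
        (hwc k).mul_right
    · exact ae_of_all _ fun x => mul_nonneg (hw0 k x) (sq_nonneg _)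
  have hlim : ∀ x, Tendsto (fun k => ENNReal.ofReal (w k x * ‖gradient f x‖ ^ 2)) atTop
      (𝓝 (ENNReal.ofReal ‖gradient f x‖)) := by
    intro x
    refine ENNReal.tendsto_ofReal ?_
    rcases (norm_nonneg (gradient f x)).eq_or_lt with h0 | h0
    · simp [← h0]
    have hη : Tendsto (fun k => η k x) atTop (𝓝 1) := by
      refine tendsto_const_nhds.congr' ?_
      obtain ⟨N, hN⟩ := exists_nat_ge ‖x‖
      filter_upwards [eventually_ge_atTop N] with k hk
      refine ((η k).one_of_mem_closedBall ?_).symm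
      have : (N : ℝ) ≤ k := by exact_mod_cast hk
      rw [mem_closedBall_zero_iff]
      change ‖x‖ ≤ (k : ℝ) + 1
      linarith
    have hε0 : Tendsto ε atTop (𝓝 0) := tendsto_one_div_add_atTop_nhds_zero_nat
    have hs : Tendsto (fun k => √(ε k ^ 2 + ‖gradient f x‖ ^ 2)) atTop (𝓝 ‖gradient f x‖) := by
      have := ((hε0.pow 2).add_const (‖gradient f x‖ ^ 2)).sqrt
      simpa using this
    have := (hη.div hs h0.ne').mul_const (‖gradient f x‖ ^ 2)
    rwa [show 1 / ‖gradient f x‖ * ‖gradient f x‖ ^ 2 = ‖gradient f x‖ by field_simp] at this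
  calc ∫⁻ x, ENNReal.ofReal ‖gradient f x‖
      = ∫⁻ x, liminf (fun k => ENNReal.ofReal (w k x * ‖gradient f x‖ ^ 2)) atTop :=
        lintegral_congr fun x => (hlim x).liminf_eq.symm
    _ ≤ liminf (fun k => ∫⁻ x, ENNReal.ofReal (w k x * ‖gradient f x‖ ^ 2)) atTop :=
        lintegral_liminf_le fun k =>
          ((hw k).continuous.mul (hG.continuous.norm.pow 2)).measurable.ennreal_ofReal
    _ ≤ ENNReal.ofReal P := liminf_le_of_le (by isBoundedDefault) fun b hb => by
        obtain ⟨k, hk⟩ := hb.exists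
        exact hk.trans (hbound k)

/-- Directional finite differences are bounded by the directional derivative. -/
lemma lintegral_sub_le {f : Plane → ℝ} (hf : ContDiff ℝ 1 f) (z : Plane) :
    ∫⁻ x, ENNReal.ofReal |f (x + z) - f x| ≤
      ∫⁻ x, ENNReal.ofReal |inner ℝ (gradient f x) z| := by
  have hc : Continuous fun x => |inner ℝ (gradient f x) z| := by
    have : Continuous (gradient f) :=
      (InnerProductSpace.toDual ℝ Plane).symm.continuous.comp (hf.continuous_fderiv one_ne_zero)
    fun_prop
  have hpt : ∀ x, ENNReal.ofReal |f (x + z) - f x| ≤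
      ∫⁻ t in Ioc (0 : ℝ) 1, ENNReal.ofReal |inner ℝ (gradient f (x + t • z)) z| := by
    intro x
    have hd : ∀ t : ℝ, HasDerivAt (fun t : ℝ => f (x + t • z))
        (inner ℝ (gradient f (x + t • z)) z) t := fun t => by
      have h1 := (hf.differentiable one_ne_zero (x + t • z)).hasFDerivAt
      have h2 : HasDerivAt (fun t : ℝ => x + t • z) z t := by
        simpa using ((hasDerivAt_id t).smul_const z).const_add x
      rw [gradient, InnerProductSpace.toDual_symm_apply]
      exact h1.comp_hasDerivAt t h2
    have hci : Continuous fun t : ℝ => inner ℝ (gradient f (x + t • z)) z := by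
      have : Continuous (gradient f) :=
        (InnerProductSpace.toDual ℝ Plane).symm.continuous.comp (hf.continuous_fderiv one_ne_zero)
      fun_prop
    have h := intervalIntegral.integral_eq_sub_of_hasDerivAt (a := 0) (b := 1)
      (fun t _ => hd t) (hci.intervalIntegrable _ _)
    simp only [one_smul, zero_smul, add_zero] at h
    rw [← h, intervalIntegral.integral_of_le zero_le_one]
    simpa only [← Real.enorm_eq_ofReal_abs] using
      enorm_integral_le_lintegral_enorm (μ := volume.restrict (Ioc (0 : ℝ) 1))
        fun t : ℝ => inner ℝ (gradient f (x + t • z)) z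
  calc ∫⁻ x, ENNReal.ofReal |f (x + z) - f x|
      ≤ ∫⁻ x, ∫⁻ t in Ioc (0 : ℝ) 1, ENNReal.ofReal |inner ℝ (gradient f (x + t • z)) z| :=
        lintegral_mono hpt
    _ = ∫⁻ t in Ioc (0 : ℝ) 1, ∫⁻ x, ENNReal.ofReal |inner ℝ (gradient f (x + t • z)) z| := by
        refine lintegral_lintegral_swap (Measurable.aemeasurable ?_)
        exact (hc.comp (by fun_prop : Continuous fun p : Plane × ℝ => p.1 + p.2 • z)).measurable
          |>.ennreal_ofReal
    _ = ∫⁻ x, ENNReal.ofReal |inner ℝ (gradient f x) z| := by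
        simp_rw [lintegral_add_right_eq_self
          (fun y => ENNReal.ofReal |inner ℝ (gradient f y) z|)]
        simp

lemma perim_nonneg {Ω : Set Plane} (hfin : HasFinPer Ω) : 0 ≤ perim Ω := by
  refine le_csSup hfin ⟨0, contDiff_const, HasCompactSupport.zero, by simp, ?_⟩
  simp [divg]

lemma setIntegral_divg_translate_le {Ω : Set Plane} (hfin : HasFinPer Ω) {φ : Plane → Plane}
    (hφ : ContDiff ℝ 1 φ) (hc : HasCompactSupport φ) (h1 : ∀ x, ‖φ x‖ ≤ 1) (t : Plane) :
    ∫ y in Ω, divg φ (y + t) ≤ perim Ω := by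
  refine le_csSup hfin ⟨fun y => φ (y + t), hφ.comp (contDiff_id.add contDiff_const),
    hc.comp_homeomorph (Homeomorph.addRight t), fun x => h1 _, ?_⟩
  simp only [divg, fderiv_comp_add_right]

lemma continuous_divg {φ : Plane → Plane} (hφ : ContDiff ℝ 1 φ) : Continuous (divg φ) := by
  have : Continuous (fderiv ℝ φ) := hφ.continuous_fderiv one_ne_zero
  unfold divg
  fun_prop

lemma hasCompactSupport_divg {φ : Plane → Plane} (hc : HasCompactSupport φ) :
    HasCompactSupport (divg φ) :=
  (hc.fderiv ℝ).comp_left (g := fun L : Plane →L[ℝ] Plane =>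
    ∑ i : Fin 2, L (EuclideanSpace.single i 1) i) (by simp)

lemma measurable_ind {Ω : Set Plane} (hΩ : MeasurableSet Ω) : Measurable (ind Ω) :=
  measurable_one.indicator hΩ

lemma ind_eq_zero_or_one (Ω : Set Plane) (x : Plane) : ind Ω x = 0 ∨ ind Ω x = 1 := by
  by_cases h : x ∈ Ω <;> simp [ind, h]

lemma locallyIntegrable_ind {Ω : Set Plane} (hΩ : MeasurableSet Ω) :
    LocallyIntegrable (ind Ω) :=
  (locallyIntegrable_const (1 : ℝ)).indicator hΩ

open scoped Convolution in
/-- Mollification does not increase the perimeter functional. -/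
lemma integral_mollify_mul_divg_le {Ω : Set Plane} (hΩ : MeasurableSet Ω) (hfin : HasFinPer Ω)
    (b : ContDiffBump (0 : Plane)) {φ : Plane → Plane}
    (hφ : ContDiff ℝ 1 φ) (hc : HasCompactSupport φ) (h1 : ∀ x, ‖φ x‖ ≤ 1) :
    ∫ x, (b.normed volume ⋆[ContinuousLinearMap.lsmul ℝ ℝ, volume] ind Ω) x * divg φ x ≤
      perim Ω := by
  have hd : Integrable (divg φ) :=
    (continuous_divg hφ).integrable_of_hasCompactSupport (hasCompactSupport_divg hc)
  have hint : Integrable (fun p : Plane × Plane =>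
      b.normed volume p.2 * ind Ω (p.1 - p.2) * divg φ p.1) (volume.prod volume) := by
    refine (hd.mul_prod (b.integrable_normed (μ := volume))).mono ?_ (ae_of_all _ fun p => ?_)
    · have h2 := b.continuous_normed (μ := volume)
      have h3 := continuous_divg hφ
      have h4 := measurable_ind hΩ
      exact (((h2.measurable.comp measurable_snd).mul
        (h4.comp (measurable_fst.sub measurable_snd))).mul
        (h3.measurable.comp measurable_fst)).aestronglyMeasurable
    · rcases ind_eq_zero_or_one Ω (p.1 - p.2) with h | h <;> simp [h]
      · positivity
      · rw [mul_comm]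
  have hswap : ∫ x, (b.normed volume ⋆[ContinuousLinearMap.lsmul ℝ ℝ, volume] ind Ω) x * divg φ x =
      ∫ t, ∫ x, b.normed volume t * ind Ω (x - t) * divg φ x := by
    rw [← integral_integral_swap hint]
    refine integral_congr_ae (ae_of_all _ fun x => ?_)
    simp only [convolution_def, ContinuousLinearMap.lsmul_apply, smul_eq_mul]
    rw [integral_mul_const]
  have hinner : ∀ t, ∫ x, b.normed volume t * ind Ω (x - t) * divg φ x =
      b.normed volume t * ∫ y in Ω, divg φ (y + t) := by
    intro t
    rw [← integral_const_mul, ← integral_indicator hΩ,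
      ← integral_add_right_eq_self (fun x => b.normed volume t * ind Ω (x - t) * divg φ x) t]
    refine integral_congr_ae (ae_of_all _ fun x => ?_)
    by_cases h : x ∈ Ω <;> simp [ind, h]
  have hint2 := hint.integral_prod_right
  simp only [hinner] at hint2
  rw [hswap]
  simp only [hinner]
  calc ∫ t, b.normed volume t * ∫ y in Ω, divg φ (y + t)
      ≤ ∫ t, b.normed volume t * perim Ω :=
        integral_mono hint2 (b.integrable_normed.mul_const _) fun t =>
          mul_le_mul_of_nonneg_left (setIntegral_divg_translate_le hfin hφ hc h1 t)
            (b.nonneg_normed t)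
    _ = perim Ω := by rw [integral_mul_const, b.integral_normed, one_mul]

open scoped Convolution in
/-- A set of finite perimeter is an a.e. limit of smooth functions whose gradients have `L¹` norm
at most the perimeter. -/
lemma exists_smooth_approx {Ω : Set Plane} (hΩ : MeasurableSet Ω) (hfin : HasFinPer Ω) :
    ∃ f : ℕ → Plane → ℝ, (∀ n, ContDiff ℝ 1 (f n)) ∧
      (∀ n, ∫⁻ x, ENNReal.ofReal ‖gradient (f n) x‖ ≤ ENNReal.ofReal (perim Ω)) ∧
      ∀ᵐ x, Tendsto (fun n => f n x) atTop (𝓝 (ind Ω x)) := by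
  let b : ℕ → ContDiffBump (0 : Plane) := fun n =>
    ⟨1 / ((n : ℝ) + 1), 2 * (1 / ((n : ℝ) + 1)), Nat.one_div_pos_of_nat,
      by linarith [Nat.one_div_pos_of_nat (α := ℝ) (n := n)]⟩
  have hsm : ∀ n, ContDiff ℝ 2
      ((b n).normed volume ⋆[ContinuousLinearMap.lsmul ℝ ℝ, volume] ind Ω) := fun n =>
    (b n).hasCompactSupport_normed.contDiff_convolution_left _ (b n).contDiff_normed
      (locallyIntegrable_ind hΩ)
  refine ⟨fun n => (b n).normed volume ⋆[ContinuousLinearMap.lsmul ℝ ℝ, volume] ind Ω,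
    fun n => (hsm n).of_le one_le_two,
    fun n => lintegral_norm_gradient_le (hsm n) fun φ hφ hc h1 =>
      integral_mollify_mul_divg_le hΩ hfin (b n) hφ hc h1,
    ContDiffBump.ae_convolution_tendsto_right_of_locallyIntegrable (K := 2) ?_
      (Eventually.of_forall fun n => le_rfl) (locallyIntegrable_ind hΩ)⟩
  have h := (tendsto_one_div_add_atTop_nhds_zero_nat (𝕜 := ℝ)).const_mul 2
  rw [mul_zero] at h
  exact h

/-- A kernel bound on linear functionals yields a nonlocal perimeter bound. -/
lemma lintegral_kernel_le {Ω : Set Plane} (hΩ : MeasurableSet Ω) (hfin : HasFinPer Ω)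
    {k : Plane → ℝ≥0∞} (hkm : Measurable k) (hktop : ∀ z, k z ≠ ∞) {C : ℝ≥0∞}
    (hC : ∀ v : Plane, ∫⁻ z, k z * ENNReal.ofReal |inner ℝ v z| = C * ENNReal.ofReal ‖v‖) :
    ∫⁻ z, k z * ∫⁻ x, ENNReal.ofReal |ind Ω (x + z) - ind Ω x| ≤
      C * ENNReal.ofReal (perim Ω) := by
  obtain ⟨f, hf, hP, hlim⟩ := exists_smooth_approx hΩ hfin
  have hmeas2 : ∀ n, Measurable fun p : Plane × Plane =>
      ENNReal.ofReal |f n (p.2 + p.1) - f n p.2| := fun n => by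
    have := (hf n).continuous
    exact Continuous.measurable (by fun_prop) |>.ennreal_ofReal
  have hbound : ∀ n, ∫⁻ z, k z * ∫⁻ x, ENNReal.ofReal |f n (x + z) - f n x| ≤
      C * ENNReal.ofReal (perim Ω) := by
    intro n
    have hGc : Continuous (gradient (f n)) :=
      (InnerProductSpace.toDual ℝ Plane).symm.continuous.comp
        ((hf n).continuous_fderiv one_ne_zero)
    have hGm : Measurable fun p : Plane × Plane =>
        ENNReal.ofReal |inner ℝ (gradient (f n) p.2) p.1| :=
      Continuous.measurable (by fun_prop) |>.ennreal_ofReal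
    calc ∫⁻ z, k z * ∫⁻ x, ENNReal.ofReal |f n (x + z) - f n x|
        ≤ ∫⁻ z, k z * ∫⁻ x, ENNReal.ofReal |inner ℝ (gradient (f n) x) z| :=
          lintegral_mono fun z => mul_le_mul_right (lintegral_sub_le (hf n) z) _
      _ = ∫⁻ z, ∫⁻ x, k z * ENNReal.ofReal |inner ℝ (gradient (f n) x) z| :=
          lintegral_congr fun z =>
            (lintegral_const_mul _ (hGm.comp (measurable_const.prodMk measurable_id))).symm
      _ = ∫⁻ x, ∫⁻ z, k z * ENNReal.ofReal |inner ℝ (gradient (f n) x) z| :=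
          lintegral_lintegral_swap ((hkm.comp measurable_fst).mul hGm).aemeasurable
      _ = ∫⁻ x, C * ENNReal.ofReal ‖gradient (f n) x‖ :=
          lintegral_congr fun x => hC _
      _ = C * ∫⁻ x, ENNReal.ofReal ‖gradient (f n) x‖ :=
          lintegral_const_mul _ hGc.norm.measurable.ennreal_ofReal
      _ ≤ _ := mul_le_mul_right (hP n) _
  have hinner : ∀ z, ∫⁻ x, ENNReal.ofReal |ind Ω (x + z) - ind Ω x| ≤
      liminf (fun n => ∫⁻ x, ENNReal.ofReal |f n (x + z) - f n x|) atTop := by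
    intro z
    refine le_trans (le_of_eq ?_) (lintegral_liminf_le fun n =>
      (hmeas2 n).comp (measurable_const.prodMk measurable_id))
    have hshift : ∀ᵐ x, Tendsto (fun n => f n (x + z)) atTop (𝓝 (ind Ω (x + z))) :=
      (measurePreserving_add_right volume z).quasiMeasurePreserving.ae hlim
    refine lintegral_congr_ae ?_
    filter_upwards [hlim, hshift] with x h1 h2
    exact (ENNReal.tendsto_ofReal (h2.sub h1).abs).liminf_eq.symm
  calc ∫⁻ z, k z * ∫⁻ x, ENNReal.ofReal |ind Ω (x + z) - ind Ω x|
      ≤ ∫⁻ z, liminf (fun n => k z * ∫⁻ x, ENNReal.ofReal |f n (x + z) - f n x|) atTop := by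
        refine lintegral_mono fun z => ?_
        rw [ENNReal.liminf_const_mul_of_ne_top (hktop z)]
        exact mul_le_mul_right (hinner z) _
    _ ≤ liminf (fun n => ∫⁻ z, k z * ∫⁻ x, ENNReal.ofReal |f n (x + z) - f n x|) atTop :=
        lintegral_liminf_le fun n => hkm.mul (hmeas2 n).lintegral_prod_right'
    _ ≤ _ := liminf_le_of_le (by isBoundedDefault) fun b hb => by
        obtain ⟨n, hn⟩ := hb.exists
        exact hn.trans (hbound n)

/-- Small-scale bound for the nonlocal term. -/
lemma lintegral_near_le {Ω : Set Plane} (hΩ : MeasurableSet Ω) (hfin : HasFinPer Ω)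
    {δ R : ℝ} (hδ : 0 < δ) (hR : δ ≤ R) :
    ∫⁻ z : Plane, (if δ < ‖z‖ ∧ ‖z‖ ≤ R then ENNReal.ofReal (1 / ‖z‖ ^ 3) else 0) *
      ∫⁻ x, ENNReal.ofReal |ind Ω (x + z) - ind Ω x| ≤
      ENNReal.ofReal (4 * log (R / δ)) * ENNReal.ofReal (perim Ω) := by
  refine lintegral_kernel_le hΩ hfin (Measurable.ite ?_ (by fun_prop) (by fun_prop))
    (fun z => ?_) (lintegral_annulus_abs_inner hδ hR)
  · exact (measurableSet_lt measurable_const measurable_norm).inter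
      (measurableSet_le measurable_norm measurable_const)
  · split_ifs <;> simp

/-- Large-scale bound for the nonlocal term. -/
lemma lintegral_far_le {Ω : Set Plane} (hΩ : MeasurableSet Ω) {m : ℝ} (hm : 0 ≤ m)
    (hvol : volume Ω = ENNReal.ofReal m) {R : ℝ} (hR : 0 < R) :
    ∫⁻ z : Plane, (if R < ‖z‖ then ENNReal.ofReal (1 / ‖z‖ ^ 3) else 0) *
      ∫⁻ x, ENNReal.ofReal |ind Ω (x + z) - ind Ω x| ≤ ENNReal.ofReal (4 * π * m / R) := by
  have hint : ∫⁻ x, ENNReal.ofReal (ind Ω x) = ENNReal.ofReal m := by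
    rw [← hvol, ← lintegral_indicator_one hΩ]
    refine lintegral_congr fun x => ?_
    by_cases h : x ∈ Ω <;> simp [ind, h]
  have hD : ∀ z, ∫⁻ x, ENNReal.ofReal |ind Ω (x + z) - ind Ω x| ≤ ENNReal.ofReal (2 * m) := by
    intro z
    calc ∫⁻ x, ENNReal.ofReal |ind Ω (x + z) - ind Ω x|
        ≤ ∫⁻ x, (ENNReal.ofReal (ind Ω (x + z)) + ENNReal.ofReal (ind Ω x)) := by
          refine lintegral_mono fun x => ?_
          rcases ind_eq_zero_or_one Ω (x + z) with h | h <;>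
          rcases ind_eq_zero_or_one Ω x with h' | h' <;> simp [h, h']
      _ = ENNReal.ofReal (2 * m) := by
          rw [lintegral_add_right _ (measurable_ind hΩ).ennreal_ofReal,
            lintegral_add_right_eq_self (fun x => ENNReal.ofReal (ind Ω x)), hint,
            ← ENNReal.ofReal_add hm hm, two_mul]
  calc _ ≤ ∫⁻ z : Plane, (if R < ‖z‖ then ENNReal.ofReal (1 / ‖z‖ ^ 3) else 0) *
        ENNReal.ofReal (2 * m) := lintegral_mono fun z => mul_le_mul_right (hD z) _
    _ = ENNReal.ofReal (4 * π * m / R) := by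
      rw [lintegral_mul_const' _ _ ENNReal.ofReal_ne_top, lintegral_tail hR,
        ← ENNReal.ofReal_mul (by positivity)]
      congr 1; ring

lemma measurable_lintegral_ind_sub {Ω : Set Plane} (hΩ : MeasurableSet Ω) :
    Measurable fun z => ∫⁻ x, ENNReal.ofReal |ind Ω (x + z) - ind Ω x| := by
  have h := measurable_ind hΩ
  have : Measurable fun p : Plane × Plane =>
      ENNReal.ofReal |ind Ω (p.2 + p.1) - ind Ω p.2| := by fun_prop
  exact this.lintegral_prod_right'

lemma enorm_nlE_le {Ω : Set Plane} (hΩ : MeasurableSet Ω) (δ : ℝ) :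
    ‖nlE δ Ω‖ₑ ≤ ∫⁻ z : Plane, (if δ < ‖z‖ then ENNReal.ofReal (1 / ‖z‖ ^ 3) else 0) *
      ∫⁻ x, ENNReal.ofReal |ind Ω (x + z) - ind Ω x| := by
  have hi := measurable_ind hΩ
  have hkm : Measurable fun z : Plane =>
      if δ < ‖z‖ then ENNReal.ofReal (1 / ‖z‖ ^ 3) else 0 :=
    Measurable.ite (measurableSet_lt measurable_const measurable_norm) (by fun_prop) (by fun_prop)
  have hpt : ∀ x z : Plane, ‖|ind Ω (x + z) - ind Ω x| ^ 2 * (gdel δ ‖z‖ / ‖z‖ ^ 3)‖ₑ =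
      (if δ < ‖z‖ then ENNReal.ofReal (1 / ‖z‖ ^ 3) else 0) *
        ENNReal.ofReal |ind Ω (x + z) - ind Ω x| := by
    intro x z
    have h1 : |ind Ω (x + z) - ind Ω x| ^ 2 = |ind Ω (x + z) - ind Ω x| := by
      rcases ind_eq_zero_or_one Ω (x + z) with h | h <;>
      rcases ind_eq_zero_or_one Ω x with h' | h' <;> simp [h, h']
    rw [h1, enorm_mul, mul_comm, Real.enorm_eq_ofReal (abs_nonneg _)]
    congr 1
    unfold gdel
    split_ifs
    · exact Real.enorm_eq_ofReal (by positivity)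
    · simp
  calc ‖nlE δ Ω‖ₑ ≤ ∫⁻ x, ∫⁻ z, ‖|ind Ω (x + z) - ind Ω x| ^ 2 * (gdel δ ‖z‖ / ‖z‖ ^ 3)‖ₑ :=
        (enorm_integral_le_lintegral_enorm _).trans
          (lintegral_mono fun x => enorm_integral_le_lintegral_enorm _)
    _ = ∫⁻ z, ∫⁻ x, (if δ < ‖z‖ then ENNReal.ofReal (1 / ‖z‖ ^ 3) else 0) *
          ENNReal.ofReal |ind Ω (x + z) - ind Ω x| := by
        simp only [hpt]
        refine lintegral_lintegral_swap (Measurable.aemeasurable ?_)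
        exact (hkm.comp measurable_snd).mul (by fun_prop)
    _ = _ := lintegral_congr fun z => lintegral_const_mul _ (by fun_prop)

lemma nlE_le_tail {Ω : Set Plane} (hΩ : MeasurableSet Ω) {m : ℝ} (hm : 0 ≤ m)
    (hvol : volume Ω = ENNReal.ofReal m) {δ : ℝ} (hδ : 0 < δ) :
    nlE δ Ω ≤ 4 * π * m / δ := by
  have h := (enorm_nlE_le hΩ δ).trans (lintegral_far_le hΩ hm hvol hδ)
  rw [← ofReal_norm, ENNReal.ofReal_le_ofReal_iff (by positivity)] at h
  exact (le_abs_self _).trans h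

lemma nlE_le {Ω : Set Plane} (hΩ : MeasurableSet Ω) (hfin : HasFinPer Ω) {m : ℝ} (hm : 0 ≤ m)
    (hvol : volume Ω = ENNReal.ofReal m) {δ R : ℝ} (hδ : 0 < δ) (hR : δ ≤ R) :
    nlE δ Ω ≤ 4 * perim Ω * log (R / δ) + 4 * π * m / R := by
  have hR0 := hδ.trans_le hR
  have hl0 : 0 ≤ log (R / δ) := log_nonneg ((one_le_div hδ).2 hR)
  have hP := perim_nonneg hfin
  have hsplit : ∀ z : Plane, (if δ < ‖z‖ then ENNReal.ofReal (1 / ‖z‖ ^ 3) else 0) =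
      (if δ < ‖z‖ ∧ ‖z‖ ≤ R then ENNReal.ofReal (1 / ‖z‖ ^ 3) else 0) +
      (if R < ‖z‖ then ENNReal.ofReal (1 / ‖z‖ ^ 3) else 0) := by
    intro z
    rcases le_or_gt ‖z‖ R with h | h
    · simp [h, h.not_gt]
    · simp [h, h.not_ge, hR.trans_lt h]
  have hkm : Measurable fun z : Plane =>
      if R < ‖z‖ then ENNReal.ofReal (1 / ‖z‖ ^ 3) else 0 :=
    Measurable.ite (measurableSet_lt measurable_const measurable_norm) (by fun_prop) (by fun_prop)
  have h := enorm_nlE_le hΩ δ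
  simp only [hsplit, add_mul] at h
  have hfar : Measurable fun z : Plane =>
      (if R < ‖z‖ then ENNReal.ofReal (1 / ‖z‖ ^ 3) else 0) *
        ∫⁻ x, ENNReal.ofReal |ind Ω (x + z) - ind Ω x| :=
    hkm.mul (measurable_lintegral_ind_sub hΩ)
  rw [lintegral_add_right _ hfar] at h
  replace h := h.trans (add_le_add (lintegral_near_le hΩ hfin hδ hR)
    (lintegral_far_le hΩ hm hvol hR0))
  rw [← ENNReal.ofReal_mul (by positivity), ← ENNReal.ofReal_add (by positivity) (by positivity),
    ← ofReal_norm, ENNReal.ofReal_le_ofReal_iff (by positivity)] at h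
  refine (le_abs_self _).trans (h.trans (le_of_eq ?_))
  ring

/-- A priori lower bound for the energy `E_{λ,δ}` in terms of the perimeter. -/
theorem stmt5 (lam δ m : ℝ) (hlam : 0 < lam) (hδ0 : 0 < δ) (hδ : δ < 1 / 2) (hm : 0 < m)
    (Ω : Set Plane) (hmeas : MeasurableSet Ω) (hfin : HasFinPer Ω)
    (hvol : volume Ω = ENNReal.ofReal m) :
    (perim Ω ≤ Real.pi * m / δ →
      Eenergy lam δ Ω ≥
        (1 - lam + lam / |Real.log δ| *
            Real.log (perim Ω / (Real.exp 1 * Real.pi * m))) * perim Ω) ∧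
    (perim Ω > Real.pi * m / δ →
      Eenergy lam δ Ω ≥ (1 - lam / |Real.log δ|) * perim Ω) := by

  have hlog : 0 < |Real.log δ| := abs_pos.2 (log_neg hδ0 (by linarith)).ne
  have hlogabs : |Real.log δ| = -Real.log δ := abs_of_neg (log_neg hδ0 (by linarith))
  have hP := perim_nonneg hfin
  have hscale : ∀ B, nlE δ Ω ≤ B →
      perim Ω - lam / (4 * |Real.log δ|) * B ≤ Eenergy lam δ Ω := fun B hB =>
    sub_le_sub_left (mul_le_mul_of_nonneg_left hB (by positivity)) _
  refine ⟨fun h => ?_, fun h => ?_⟩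
  · rcases hP.eq_or_lt with h0 | h0
    · have hnl : nlE δ Ω ≤ 0 := by
        have hlim : Tendsto (fun R : ℝ => 4 * π * m / R) atTop (𝓝 0) :=
          tendsto_const_nhds.div_atTop tendsto_id
        refine ge_of_tendsto hlim ?_
        filter_upwards [eventually_ge_atTop δ] with R hR
        have := nlE_le hmeas hfin hm.le hvol hδ0 hR
        simpa [← h0] using this
      have := hscale 0 hnl
      rw [← h0] at this ⊢
      simpa using this
    · have hR : δ ≤ π * m / perim Ω := by
        rw [le_div_iff₀ hδ0] at h
        rw [le_div_iff₀ h0]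
        linarith
      refine le_trans (le_of_eq ?_) (hscale _ (nlE_le hmeas hfin hm.le hvol hδ0 hR))
      have hpi := pi_pos
      have e1 : log (perim Ω / (exp 1 * π * m)) = log (perim Ω) - (1 + log π + log m) := by
        rw [log_div (by positivity) (by positivity), log_mul (by positivity) (by positivity),
          log_mul (by positivity) (by positivity), log_exp]
      have e2 : log (π * m / perim Ω / δ) = log π + log m - log (perim Ω) - log δ := by
        rw [log_div (by positivity) (by positivity), log_div (by positivity) (by positivity),
          log_mul (by positivity) (by positivity)]
      have e3 : 4 * π * m / (π * m / perim Ω) = 4 * perim Ω := by field_simp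
      have hne : Real.log δ ≠ 0 := (log_neg hδ0 (by linarith)).ne
      rw [e1, e2, e3, hlogabs]
      field_simp
      ring
  · have hB : nlE δ Ω ≤ 4 * perim Ω := by
      refine (nlE_le_tail hmeas hm.le hvol hδ0).trans ?_
      have : 4 * π * m / δ = 4 * (π * m / δ) := by ring
      linarith
    refine le_trans (le_of_eq ?_) (hscale _ hB)
    field_simp
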